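/- There do not exist five triples (x_j, y_j, z_j) ∈ ℝ³, j = 1, …, 5, satisfying all of the following: x_j² + y_j² + z_j² = 1/2 for every j; Σ_{j=1}^5 x_j = Σ_{j=1}^5 y_j = Σ_{j=1}^5 z_j = 0; Σ_{j=1}^5 x_j y_j = Σ_{j=1}^5 x_j z_j = Σ_{j=1}^5 y_j z_j = 0; and Σ_{j=1}^5 x_j² = Σ_{j=1}^5 y_j² = Σ_{j=1}^5 z_j² = 5/6. -/

import Mathlib

/-- Fewer than `n` linear forms on `ℝⁿ` have a common nontrivial zero. -/
theorem Matrix.exists_ne_zero_mulVec_eq_zero_of_lt {m n : ℕ} (h : m < n)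
    (A : Matrix (Fin m) (Fin n) ℝ) : ∃ w : Fin n → ℝ, w ≠ 0 ∧ A.mulVec w = 0 := by
  have hker : LinearMap.ker A.mulVecLin ≠ ⊥ :=
    LinearMap.ker_ne_bot_of_finrank_lt (by simpa using h)
  obtain ⟨w, hw, hw0⟩ := Submodule.exists_mem_ne_zero_of_ne_bot hker
  exact ⟨w, hw0, by simpa using hw⟩

/-- If the rows of a square matrix are orthogonal with nonzero squared norms `d i`, then the
squares in each column, weighted by `(d i)⁻¹`, sum to one. -/
theorem Matrix.sum_inv_mul_sq_eq_one {n : Type*} [Fintype n] [DecidableEq n]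
    {B : Matrix n n ℝ} {d : n → ℝ} (hd : ∀ i, d i ≠ 0)
    (h : B * B.transpose = Matrix.diagonal d) (j : n) :
    ∑ i, (d i)⁻¹ * B i j ^ 2 = 1 := by
  have hright : B * (B.transpose * Matrix.diagonal d⁻¹) = 1 := by
    rw [← Matrix.mul_assoc, h, Matrix.diagonal_mul_diagonal, ← Matrix.diagonal_one]
    congr 1
    ext i
    exact mul_inv_cancel₀ (hd i)
  have hleft : (B.transpose * Matrix.diagonal d⁻¹ * B) j j = (1 : Matrix n n ℝ) j j := by
    rw [mul_eq_one_comm.mp hright]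
  rw [Matrix.mul_apply, Matrix.one_apply_eq] at hleft
  rw [← hleft]
  refine Finset.sum_congr rfl fun i _ => ?_
  rw [Matrix.mul_diagonal, Matrix.transpose_apply, Pi.inv_apply]
  ring

/-- If five real numbers sum to zero and all have square `c ^ 2`, then `c = 0`. -/
theorem eq_zero_of_sq_eq_of_sum_fin_five_eq_zero {w : Fin 5 → ℝ} {c : ℝ}
    (hsq : ∀ j, w j ^ 2 = c ^ 2) (hsum : ∑ j, w j = 0) : c = 0 := by
  simp only [Fin.sum_univ_five] at hsum
  rcases sq_eq_sq_iff_eq_or_eq_neg.mp (hsq 0) with h0 | h0 <;>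
  rcases sq_eq_sq_iff_eq_or_eq_neg.mp (hsq 1) with h1 | h1 <;>
  rcases sq_eq_sq_iff_eq_or_eq_neg.mp (hsq 2) with h2 | h2 <;>
  rcases sq_eq_sq_iff_eq_or_eq_neg.mp (hsq 3) with h3 | h3 <;>
  rcases sq_eq_sq_iff_eq_or_eq_neg.mp (hsq 4) with h4 | h4 <;>
  linarith

/-- Appendix B: there is no optimal one-qubit probe state set with `M = 5`
states. In Bloch coordinates `(x_j, y_j, z_j)` (with `x_j² + y_j² + z_j² = 1/2`
for pure states), no five triples satisfy the first- and second-moment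
conditions characterizing optimality (`XᵀX = diag(5/2, 5/6, 5/6, 5/6)`). -/
theorem stmt_19 :
    ¬ ∃ x y z : Fin 5 → ℝ,
      (∀ j, x j ^ 2 + y j ^ 2 + z j ^ 2 = 1 / 2) ∧
      (∑ j, x j = 0) ∧ (∑ j, y j = 0) ∧ (∑ j, z j = 0) ∧
      (∑ j, x j * y j = 0) ∧ (∑ j, x j * z j = 0) ∧ (∑ j, y j * z j = 0) ∧
      (∑ j, x j ^ 2 = 5 / 6) ∧ (∑ j, y j ^ 2 = 5 / 6) ∧ (∑ j, z j ^ 2 = 5 / 6) := by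
  rintro ⟨x, y, z, hnorm, hx, hy, hz, hxy, hxz, hyz, hxx, hyy, hzz⟩
  obtain ⟨w, hw0, hw⟩ :=
    Matrix.exists_ne_zero_mulVec_eq_zero_of_lt (by norm_num) (Matrix.of ![1, x, y, z])
  have hw1 : ∑ j, w j = 0 := by
    simpa [Matrix.mulVec, dotProduct] using congrFun hw 0
  have hxw : ∑ j, x j * w j = 0 := by
    simpa [Matrix.mulVec, dotProduct] using congrFun hw 1
  have hyw : ∑ j, y j * w j = 0 := by
    simpa [Matrix.mulVec, dotProduct] using congrFun hw 2
  have hzw : ∑ j, z j * w j = 0 := by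
    simpa [Matrix.mulVec, dotProduct] using congrFun hw 3
  set s := ∑ j, w j ^ 2 with hs
  have hs0 : s ≠ 0 := by
    contrapose! hw0
    ext j
    have hzero := (Finset.sum_eq_zero_iff_of_nonneg fun i _ => sq_nonneg (w i)).mp hw0
    exact pow_eq_zero_iff two_ne_zero |>.mp (hzero j (Finset.mem_univ j))
  have horth : (Matrix.of ![1, x, y, z, w]) * (Matrix.of ![1, x, y, z, w]).transpose =
      Matrix.diagonal ![5, 5 / 6, 5 / 6, 5 / 6, s] := by
    simp only [Fin.sum_univ_five] at *
    ext i k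
    fin_cases i <;> fin_cases k <;>
      simp [Matrix.mul_apply, Fin.sum_univ_five, Matrix.diagonal] <;> linarith
  have hd : ∀ i, (![5, 5 / 6, 5 / 6, 5 / 6, s] : Fin 5 → ℝ) i ≠ 0 := by
    intro i
    fin_cases i <;> simp [hs0]
  have hsq : ∀ j, w j ^ 2 = s / 5 := by
    intro j
    have hcol := Matrix.sum_inv_mul_sq_eq_one hd horth j
    simp [Fin.sum_univ_five] at hcol
    have hj : s⁻¹ * w j ^ 2 = 1 / 5 := by linarith [hnorm j]
    field_simp at hj
    linarith
  have hw_zero := eq_zero_of_sq_eq_of_sum_fin_five_eq_zero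
    (fun j => (hsq j).trans (hsq 0).symm) hw1
  have hs_zero := hsq 0
  rw [hw_zero] at hs_zero
  exact hs0 (by linarith)
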